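/- Let ψ : ℕ → ℝ be any function defined on the positive integers such that ψ(n) → ∞ as n → ∞. Then A₀(n) ≤ n^{ψ(n)} for almost all n; that is, the set of n for which this inequality fails has asymptotic density 0 (i.e., #{n ≤ x : A₀(n) > n^{ψ(n)}}/x → 0 as x → ∞). -/

import Mathlib

open Polynomial Filter
open scoped Classical

/-- Height of an integer polynomial: max absolute value of coefficients. -/
def polyHeight (f : Polynomial ℤ) : ℕ := f.support.sup fun i => (f.coeff i).natAbs

/-- A(n): height of the n-th cyclotomic polynomial. -/
noncomputable def A (n : ℕ) : ℕ := polyHeight (Polynomial.cyclotomic n ℤ)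

/-- B(n): max height over all integer polynomial divisors of x^n - 1. -/
noncomputable def B (n : ℕ) : ℕ :=
  sSup {h : ℕ | ∃ f : Polynomial ℤ, f ∣ (Polynomial.X ^ n - 1) ∧ polyHeight f = h}

/-- A₀(n): max of A(d) over positive divisors d of n. -/
noncomputable def A0 (n : ℕ) : ℕ := n.divisors.sup A

/-- τ(n): number of positive divisors of n. -/
def tau (n : ℕ) : ℕ := n.divisors.card

/-- ω(n): number of distinct prime factors of n. -/
def omegaCount (n : ℕ) : ℕ := n.primeFactors.card

/-- p_k(n): the k-th largest distinct prime factor of n (1-indexed), or 1 if k > ω(n). -/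
def pk (n k : ℕ) : ℕ :=
  if k ≤ n.primeFactors.card then
    (n.primeFactors.sort (· ≤ ·)).getD (n.primeFactors.card - k) 1
  else 1

/-- ω([t,x],n): number of distinct prime factors of n lying in the real interval [t,x]. -/
noncomputable def omegaInterval (t x : ℝ) (n : ℕ) : ℕ :=
  (n.primeFactors.filter fun p : ℕ => t ≤ (p : ℝ) ∧ (p : ℝ) ≤ x).card

/-- rad(n): the radical (product of the distinct prime factors) of n. -/
def rad (n : ℕ) : ℕ := ∏ p ∈ n.primeFactors, p

/-- The length of an integer polynomial: the sum of the absolute values of its coefficients. -/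
def polyLength (f : ℤ[X]) : ℕ := ∑ i ∈ f.support, (f.coeff i).natAbs

lemma polyLength_eq_sum_of_support_subset {f : ℤ[X]} {s : Finset ℕ} (h : f.support ⊆ s) :
    polyLength f = ∑ i ∈ s, (f.coeff i).natAbs := by
  refine Finset.sum_subset h fun i _ hi => ?_
  simpa using hi

lemma natAbs_coeff_le_polyHeight (f : ℤ[X]) (i : ℕ) : (f.coeff i).natAbs ≤ polyHeight f := by
  by_cases hi : i ∈ f.support
  · exact Finset.le_sup (f := fun i => (f.coeff i).natAbs) hi
  · simp [notMem_support_iff.mp hi]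

lemma polyHeight_le_iff {f : ℤ[X]} {b : ℕ} :
    polyHeight f ≤ b ↔ ∀ i, (f.coeff i).natAbs ≤ b :=
  ⟨fun h i => (natAbs_coeff_le_polyHeight f i).trans h, fun h => Finset.sup_le fun i _ => h i⟩

lemma polyHeight_X_sub_one_le : polyHeight (X - 1) ≤ 1 :=
  polyHeight_le_iff.mpr fun i => by
    rw [coeff_sub, coeff_X, coeff_one]
    split_ifs <;> simp

lemma sum_natAbs_coeff_le_polyLength (f : ℤ[X]) (s : Finset ℕ) :
    ∑ i ∈ s, (f.coeff i).natAbs ≤ polyLength f := by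
  rw [polyLength_eq_sum_of_support_subset (Finset.subset_union_left (s₂ := s))]
  exact Finset.sum_le_sum_of_subset Finset.subset_union_right

lemma polyHeight_le_polyLength (f : ℤ[X]) : polyHeight f ≤ polyLength f :=
  polyHeight_le_iff.mpr fun i => by simpa using sum_natAbs_coeff_le_polyLength f {i}

lemma polyLength_le_natDegree_mul_polyHeight (f : ℤ[X]) :
    polyLength f ≤ (f.natDegree + 1) * polyHeight f := by
  rw [polyLength_eq_sum_of_support_subset supp_subset_range_natDegree_succ]
  simpa using Finset.sum_le_card_nsmul (Finset.range (f.natDegree + 1))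
    (fun i => (f.coeff i).natAbs) _ fun i _ => natAbs_coeff_le_polyHeight f i

lemma polyLength_add_le (f g : ℤ[X]) : polyLength (f + g) ≤ polyLength f + polyLength g := by
  rw [polyLength_eq_sum_of_support_subset (support_add (p := f) (q := g)),
    polyLength_eq_sum_of_support_subset (Finset.subset_union_left (s₁ := f.support)
      (s₂ := g.support)),
    polyLength_eq_sum_of_support_subset (Finset.subset_union_right (s₁ := f.support)
      (s₂ := g.support)), ← Finset.sum_add_distrib]
  exact Finset.sum_le_sum fun i _ => by simpa using Int.natAbs_add_le _ _

lemma polyLength_monomial_mul (n : ℕ) (a : ℤ) (g : ℤ[X]) :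
    polyLength (monomial n a * g) ≤ a.natAbs * polyLength g := by
  have h : (monomial n a * g).support ⊆ g.support.map (addRightEmbedding n) := by
    intro i hi
    rw [mem_support_iff, ← C_mul_X_pow_eq_monomial, mul_assoc, coeff_C_mul, coeff_X_pow_mul'] at hi
    split_ifs at hi with hni
    · simp only [Finset.mem_map, addRightEmbedding_apply, mem_support_iff]
      exact ⟨i - n, right_ne_zero_of_mul hi, by omega⟩
    · simp at hi
  rw [polyLength_eq_sum_of_support_subset h, Finset.sum_map, polyLength, Finset.mul_sum]
  refine Finset.sum_le_sum fun i _ => ?_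
  simp [← C_mul_X_pow_eq_monomial, mul_assoc, coeff_X_pow_mul', Int.natAbs_mul]

lemma polyLength_mul_le (f g : ℤ[X]) : polyLength (f * g) ≤ polyLength f * polyLength g := by
  have key : ∀ s : Finset ℕ, polyLength ((∑ i ∈ s, monomial i (f.coeff i)) * g) ≤
      (∑ i ∈ s, (f.coeff i).natAbs) * polyLength g := by
    intro s
    induction s using Finset.induction_on with
    | empty => simp [polyLength]
    | insert a s ha ih =>
      rw [Finset.sum_insert ha, Finset.sum_insert ha, add_mul, add_mul]
      exact (polyLength_add_le _ _).trans
        (add_le_add (polyLength_monomial_mul _ _ _) ih)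
  have := key f.support
  rwa [← as_sum_support f] at this

lemma polyLength_expand {p : ℕ} (hp : 0 < p) (f : ℤ[X]) :
    polyLength (expand ℤ p f) = polyLength f := by
  have h : (expand ℤ p f).support ⊆ f.support.image (· * p) := by
    intro i hi
    rw [mem_support_iff, coeff_expand hp] at hi
    split_ifs at hi with hd
    · exact Finset.mem_image.mpr ⟨i / p, mem_support_iff.mpr hi, Nat.div_mul_cancel hd⟩
    · exact absurd rfl hi
  rw [polyLength_eq_sum_of_support_subset h, Finset.sum_image fun a _ b _ hab =>
    Nat.eq_of_mul_eq_mul_right hp hab]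
  simp [polyLength, coeff_expand_mul hp]

lemma polyHeight_expand {p : ℕ} (hp : 0 < p) (f : ℤ[X]) :
    polyHeight (expand ℤ p f) ≤ polyHeight f := by
  refine polyHeight_le_iff.mpr fun i => ?_
  rw [coeff_expand hp]
  split_ifs
  · exact natAbs_coeff_le_polyHeight f _
  · simp

lemma polyHeight_le_polyLength_of_X_pow_sub_one_mul {m : ℕ} (hm : 0 < m) {f g : ℤ[X]}
    (h : (X ^ m - 1) * g = f) : polyHeight g ≤ polyLength f := by
  have key : ∀ i, (g.coeff i).natAbs ≤ ∑ j ∈ Finset.range (i + 1), (f.coeff j).natAbs := by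
    intro i
    induction i using Nat.strong_induction_on with
    | _ i ih =>
      have hi : f.coeff i = (if m ≤ i then g.coeff (i - m) else 0) - g.coeff i := by
        rw [← h, sub_mul, one_mul, coeff_sub, coeff_X_pow_mul']
      rw [Finset.sum_range_succ]
      split_ifs at hi with hmi
      · have h1 := ih (i - m) (by omega)
        have h2 : ∑ j ∈ Finset.range (i - m + 1), (f.coeff j).natAbs ≤
            ∑ j ∈ Finset.range i, (f.coeff j).natAbs :=
          Finset.sum_le_sum_of_subset (Finset.range_mono (by omega))
        omega
      · omega
  exact polyHeight_le_iff.mpr fun i => (key i).trans (sum_natAbs_coeff_le_polyLength f _)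

lemma cyclotomic_mul_eq_expand {m k : ℕ} (hk : k ≠ 0) (h : ∀ p, p.Prime → p ∣ k → p ∣ m) :
    cyclotomic (m * k) ℤ = expand ℤ k (cyclotomic m ℤ) := by
  induction k using induction_on_primes generalizing m with
  | zero => exact absurd rfl hk
  | one => simp
  | prime_mul p k hp ih =>
    have hpm : p ∣ m := h p hp (dvd_mul_right p k)
    rw [← expand_expand, ← ih (right_ne_zero_of_mul hk) fun q hq hqk => h q hq (hqk.mul_left p),
      cyclotomic_expand_eq_cyclotomic hp (hpm.mul_right k)]
    congr 1
    ring

lemma A_le_A_prod_primeFactors {n : ℕ} (hn : n ≠ 0) : A n ≤ A (∏ p ∈ n.primeFactors, p) := by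
  obtain ⟨k, hk⟩ := Nat.prod_primeFactors_dvd n
  have hk0 : k ≠ 0 := by rintro rfl; simp [hn] at hk
  have : cyclotomic n ℤ = expand ℤ k (cyclotomic (∏ p ∈ n.primeFactors, p) ℤ) := by
    rw [← cyclotomic_mul_eq_expand hk0, ← hk]
    intro p hp hpk
    exact Finset.dvd_prod_of_mem _ (Nat.mem_primeFactors.mpr ⟨hp, hk ▸ hpk.mul_left _, hn⟩)
  rw [A, this]
  exact polyHeight_expand (Nat.pos_of_ne_zero hk0) _

/-- The weighted sum `∑ 2 ^ #{q ∈ P | p < q} * log p` over `p ∈ P`. -/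
noncomputable def chainSum (P : Finset ℕ) : ℝ :=
  ∑ p ∈ P, 2 ^ (P.filter (p < ·)).card * Real.log p

lemma chainSum_mono {P Q : Finset ℕ} (h : P ⊆ Q) : chainSum P ≤ chainSum Q := by
  refine (Finset.sum_le_sum fun p _ => ?_).trans
    (Finset.sum_le_sum_of_subset_of_nonneg h fun p _ _ => ?_)
  · have := Real.log_natCast_nonneg p
    gcongr
    norm_num
  · have := Real.log_natCast_nonneg p
    positivity

lemma chainSum_insert_of_forall_lt {P : Finset ℕ} {a : ℕ} (h : ∀ p ∈ P, p < a) :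
    chainSum (insert a P) = 2 * chainSum P + Real.log a := by
  have ha : a ∉ P := fun ha => lt_irrefl _ (h a ha)
  have h0 : (insert a P).filter (a < ·) = ∅ := by
    refine Finset.filter_eq_empty_iff.mpr fun q hq => ?_
    rcases Finset.mem_insert.mp hq with rfl | hq
    · exact lt_irrefl _
    · exact (h q hq).not_gt
  rw [chainSum, Finset.sum_insert ha, h0, chainSum, Finset.mul_sum, add_comm]
  congr 1
  · refine Finset.sum_congr rfl fun p hp => ?_
    rw [Finset.filter_insert, if_pos (h p hp), Finset.card_insert_of_notMem (by simp [ha])]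
    ring
  · simp

lemma two_pow_card_mul_log_two_le {P : Finset ℕ} (hP : ∀ p ∈ P, p.Prime) (hne : P.Nonempty) :
    2 ^ P.card * Real.log 2 ≤ 2 * chainSum P := by
  set a := P.min' hne
  have ha : a ∈ P := P.min'_mem hne
  have h1 : P.filter (a < ·) = P.erase a := by
    ext q
    simp only [Finset.mem_filter, Finset.mem_erase]
    exact ⟨fun h => ⟨h.2.ne', h.1⟩, fun h => ⟨h.2, lt_of_le_of_ne (P.min'_le q h.2) h.1.symm⟩⟩
  have h2 : 2 ^ (P.filter (a < ·)).card * Real.log a ≤ chainSum P :=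
    Finset.single_le_sum (f := fun p : ℕ => (2 : ℝ) ^ (P.filter (p < ·)).card * Real.log p)
      (fun p _ => by have := Real.log_natCast_nonneg p; positivity) ha
  have h3 : Real.log 2 ≤ Real.log a :=
    Real.log_le_log two_pos (by exact_mod_cast (hP a ha).two_le)
  have h4 : P.card = (P.filter (a < ·)).card + 1 := by
    rw [h1, Finset.card_erase_add_one ha]
  rw [h4, pow_succ]
  nlinarith [pow_pos (two_pos (α := ℝ)) (P.filter (a < ·)).card]

/-- For `m` a product of distinct primes, both `Φ_m` and its cofactor in `X ^ m - 1` have length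
bounded in terms of the `chainSum` of the prime factors of `m`. -/
lemma exists_cofactor_polyLength_le (P : Finset ℕ) (hP : ∀ p ∈ P, p.Prime) :
    ∃ f : ℤ[X], cyclotomic (∏ p ∈ P, p) ℤ * f = X ^ (∏ p ∈ P, p) - 1 ∧
      ∀ g ∈ ({cyclotomic (∏ p ∈ P, p) ℤ, f} : Set ℤ[X]), (polyLength g : ℝ) ≤
        Real.exp (2 ^ P.card * Real.log 2 + 2 * chainSum P - ∑ p ∈ P, Real.log p) := by
  induction P using Finset.induction_on_max with
  | empty =>
    refine ⟨1, by simp, ?_⟩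
    have h1 : polyLength (X - 1) ≤ 2 :=
      (polyLength_le_natDegree_mul_polyHeight _).trans (by
        have := polyHeight_X_sub_one_le
        have h2 : (X - 1 : ℤ[X]).natDegree = 1 := by simpa using natDegree_X_sub_C (1 : ℤ)
        rw [h2]; omega)
    have h2 : polyLength 1 ≤ 2 := by
      have h3 : polyLength 1 ≤ 1 * 1 :=
        (polyLength_le_natDegree_mul_polyHeight _).trans (by
          have : polyHeight 1 ≤ 1 := polyHeight_le_iff.mpr fun i => by
            rw [coeff_one]
            split_ifs <;> simp
          simpa using this)
      omega
    simp only [Finset.prod_empty, cyclotomic_one, Set.mem_insert_iff, Set.mem_singleton_iff,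
      forall_eq_or_imp, forall_eq, chainSum, Finset.card_empty, pow_zero, one_mul,
      Finset.sum_empty, mul_zero, add_zero, sub_zero, Real.exp_log two_pos]
    exact ⟨by exact_mod_cast h1, by exact_mod_cast h2⟩
  | insert a P ha ih =>
    have haP : a ∉ P := fun h => lt_irrefl _ (ha a h)
    have hpa : a.Prime := hP a (Finset.mem_insert_self a P)
    have hP' : ∀ p ∈ P, p.Prime := fun p hp => hP p (Finset.mem_insert_of_mem hp)
    obtain ⟨f, hf, hlen⟩ := ih hP'
    rw [Finset.prod_insert haP, Finset.sum_insert haP, Finset.card_insert_of_notMem haP,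
      chainSum_insert_of_forall_lt ha, mul_comm a]
    set m := ∏ p ∈ P, p with hm
    have hm0 : 0 < m := Finset.prod_pos fun p hp => (hP' p hp).pos
    have ham : ¬ a ∣ m := by
      intro h
      obtain ⟨p, hp, hap⟩ := (hpa.prime.dvd_finsetProd_iff _).mp h
      exact haP ((Nat.prime_dvd_prime_iff_eq hpa (hP' p hp)).mp hap ▸ hp)
    have hexp := cyclotomic_expand_eq_cyclotomic_mul hpa ham ℤ
    set E := Real.exp (2 ^ P.card * Real.log 2 + 2 * chainSum P - ∑ p ∈ P, Real.log p) with hE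
    have hlog : ∑ p ∈ P, Real.log p = Real.log m := by
      rw [hm, Nat.cast_prod, Real.log_prod fun p hp => by exact_mod_cast (hP' p hp).ne_zero]
    have hma : (0 : ℝ) < m * a := by exact_mod_cast Nat.mul_pos hm0 hpa.pos
    have hE' : Real.exp (2 ^ (P.card + 1) * Real.log 2 + 2 * (2 * chainSum P + Real.log a) -
        (Real.log a + ∑ p ∈ P, Real.log p)) = (m * a) * (E * E) := by
      rw [hE, ← Real.exp_add, ← Real.exp_log hma, ← Real.exp_add, Real.log_mul
        (by positivity) (by exact_mod_cast hpa.ne_zero), ← hlog]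
      congr 1
      ring
    rw [hE']
    have h1 := hlen (cyclotomic m ℤ) (by simp)
    have h2 := hlen f (by simp)
    have h12 : (polyLength (cyclotomic m ℤ) : ℝ) * polyLength f ≤ E * E :=
      mul_le_mul h1 h2 (by positivity) (by positivity)
    refine ⟨expand ℤ a f * cyclotomic m ℤ, ?_, ?_⟩
    · rw [mul_comm (expand ℤ a f), ← mul_assoc, ← hexp, ← map_mul, hf]
      simp [← pow_mul, mul_comm a m]
    · have h3 : polyHeight (cyclotomic (m * a) ℤ) ≤ polyLength (cyclotomic m ℤ) * polyLength f := by
        refine (polyHeight_le_polyLength_of_X_pow_sub_one_mul hm0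
          (f := expand ℤ a (cyclotomic m ℤ) * f) ?_).trans ?_
        · rw [hexp, ← hf]; ring
        · refine (polyLength_mul_le _ _).trans ?_
          rw [polyLength_expand hpa.pos]
      have h4 : polyLength (cyclotomic (m * a) ℤ) ≤
          m * a * (polyLength (cyclotomic m ℤ) * polyLength f) := by
        refine (polyLength_le_natDegree_mul_polyHeight _).trans (Nat.mul_le_mul ?_ h3)
        rw [natDegree_cyclotomic]
        exact Nat.totient_lt _ (hpa.one_lt.trans_le (Nat.le_mul_of_pos_left a hm0))
      have h5 : polyLength (expand ℤ a f * cyclotomic m ℤ) ≤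
          polyLength (cyclotomic m ℤ) * polyLength f := by
        refine (polyLength_mul_le _ _).trans ?_
        rw [polyLength_expand hpa.pos, mul_comm]
      have h6 : (1 : ℝ) ≤ m * a := by exact_mod_cast Nat.mul_pos hm0 hpa.pos
      simp only [Set.mem_insert_iff, Set.mem_singleton_iff, forall_eq_or_imp, forall_eq]
      constructor
      · calc (polyLength (cyclotomic (m * a) ℤ) : ℝ)
            ≤ m * a * (polyLength (cyclotomic m ℤ) * polyLength f) := by exact_mod_cast h4
          _ ≤ _ := by gcongr
      · calc (polyLength (expand ℤ a f * cyclotomic m ℤ) : ℝ)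
            ≤ polyLength (cyclotomic m ℤ) * polyLength f := by exact_mod_cast h5
          _ ≤ E * E := h12
          _ ≤ _ := le_mul_of_one_le_left (by positivity) h6

lemma A_le_exp_chainSum {n : ℕ} (hn : n ≠ 0) :
    (A n : ℝ) ≤ Real.exp (4 * chainSum n.primeFactors) := by
  have hP : ∀ p ∈ n.primeFactors, p.Prime := fun p hp => Nat.prime_of_mem_primeFactors hp
  have hA : (A n : ℝ) ≤ A (∏ p ∈ n.primeFactors, p) := by
    exact_mod_cast A_le_A_prod_primeFactors hn
  refine hA.trans ?_
  rcases n.primeFactors.eq_empty_or_nonempty with he | hne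
  · rw [he]
    have : A 1 ≤ 1 := by
      rw [A, cyclotomic_one]
      exact polyHeight_X_sub_one_le
    simpa [chainSum] using this
  · obtain ⟨f, -, hlen⟩ := exists_cofactor_polyLength_le n.primeFactors hP
    have h1 := hlen _ (Set.mem_insert _ _)
    have h2 : (A (∏ p ∈ n.primeFactors, p) : ℝ) ≤
        polyLength (cyclotomic (∏ p ∈ n.primeFactors, p) ℤ) := by
      exact_mod_cast polyHeight_le_polyLength _
    refine h2.trans (h1.trans (Real.exp_le_exp.mpr ?_))
    have h3 := two_pow_card_mul_log_two_le hP hne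
    have h4 : 0 ≤ ∑ p ∈ n.primeFactors, Real.log p :=
      Finset.sum_nonneg fun p _ => Real.log_natCast_nonneg p
    linarith

lemma A0_le_exp_chainSum {n : ℕ} (hn : n ≠ 0) :
    (A0 n : ℝ) ≤ Real.exp (4 * chainSum n.primeFactors) := by
  obtain ⟨d, hd, hAd⟩ := Finset.exists_mem_eq_sup n.divisors ⟨1, by simp [hn]⟩ A
  rw [A0, hAd]
  have hdn := Nat.dvd_of_mem_divisors hd
  refine (A_le_exp_chainSum (ne_zero_of_dvd_ne_zero hn hdn)).trans (Real.exp_le_exp.mpr ?_)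
  have := chainSum_mono (Nat.primeFactors_mono hdn hn)
  linarith

/-- Partial summation against the Chebyshev bound `θ(n) ≤ n log 4`. -/
lemma sum_primes_log_mul_le {a b : ℕ} (hab : a ≤ b) {w : ℕ → ℝ}
    (hw : ∀ m > a, w (m + 1) ≤ w m) (hw0 : ∀ m > a, 0 ≤ w m) :
    ∑ q ∈ (Finset.Ioc a b).filter Nat.Prime, Real.log q * w q ≤
      Real.log 4 * (a * w (a + 1) + ∑ m ∈ Finset.Ioc a b, w m) := by
  have hθ : ∀ n : ℕ, Chebyshev.theta n ≤ Real.log 4 * n := fun n =>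
    Chebyshev.theta_le_log4_mul_x n.cast_nonneg
  have hsucc : ∀ n : ℕ, Chebyshev.theta (n + 1 : ℕ) =
      Chebyshev.theta n + if (n + 1).Prime then Real.log (n + 1 : ℕ) else 0 := by
    intro n
    simp only [Chebyshev.theta, Nat.floor_natCast, Finset.sum_filter]
    rw [← Finset.insert_Ioc_right_eq_Ioc_add_one (Nat.zero_le n),
      Finset.sum_insert (by simp), add_comm]
  suffices h : ∑ q ∈ Finset.Ioc a b, (if q.Prime then Real.log q * w q else 0) ≤
      Real.log 4 * (a * w (a + 1) + ∑ m ∈ Finset.Ioc a b, w m) -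
        (Real.log 4 * b - Chebyshev.theta b) * w (b + 1) by
    rw [Finset.sum_filter]
    nlinarith [mul_nonneg (sub_nonneg.mpr (hθ b)) (hw0 (b + 1) (by omega))]
  induction b, hab using Nat.le_induction with
  | base =>
    simp only [Finset.Ioc_self, Finset.sum_empty]
    nlinarith [mul_nonneg (Chebyshev.theta_nonneg a) (hw0 (a + 1) (by omega))]
  | succ n hn ih =>
    rw [← Finset.insert_Ioc_right_eq_Ioc_add_one hn, Finset.sum_insert (by simp),
      Finset.sum_insert (by simp)]
    have h1 := hsucc n
    have h2 := mul_nonneg (sub_nonneg.mpr (hθ (n + 1))) (sub_nonneg.mpr (hw (n + 1) (by omega)))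
    split_ifs at h1 ⊢ with hp
    · rw [h1] at h2 ⊢
      push_cast at h2 ih ⊢
      nlinarith
    · rw [h1] at h2 ⊢
      push_cast at h2 ih ⊢
      nlinarith

lemma inv_mul_log_le_log_log_sub {m : ℕ} (hm : 3 ≤ m) :
    1 / ((m : ℝ) * Real.log m) ≤ Real.log (Real.log m) - Real.log (Real.log (m - 1 : ℕ)) := by
  have hm' : (3 : ℝ) ≤ m := by exact_mod_cast hm
  rw [Nat.cast_sub (by omega), Nat.cast_one]
  have hu : 0 < Real.log ((m : ℝ) - 1) := Real.log_pos (by linarith)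
  have hv : 0 < Real.log m := Real.log_pos (by linarith)
  have h1 : Real.log ((m - 1 : ℝ) / m) ≤ (m - 1 : ℝ) / m - 1 :=
    Real.log_le_sub_one_of_pos (by apply div_pos <;> linarith)
  have h2 := Real.log_le_sub_one_of_pos (div_pos hu hv)
  rw [Real.log_div (by linarith) (by linarith)] at h1
  rw [Real.log_div hu.ne' hv.ne'] at h2
  have h3 : (m - 1 : ℝ) / m - 1 = - (1 / m) := by field_simp; ring
  have h4 : 1 / ((m : ℝ) * Real.log m) ≤ 1 - Real.log (m - 1) / Real.log m := by
    rw [one_sub_div hv.ne', ← div_div]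
    gcongr
    linarith
  linarith

lemma sum_Ioc_le_sub {a b : ℕ} (hab : a ≤ b) {w F : ℕ → ℝ}
    (h : ∀ m > a, w m ≤ F m - F (m - 1)) : ∑ m ∈ Finset.Ioc a b, w m ≤ F b - F a := by
  induction b, hab using Nat.le_induction with
  | base => simp
  | succ n hn ih =>
    rw [← Finset.insert_Ioc_right_eq_Ioc_add_one hn, Finset.sum_insert (by simp)]
    have := h (n + 1) (by omega)
    rw [Nat.add_sub_cancel] at this
    linarith

lemma sum_primes_inv_le {a b : ℕ} (ha : 2 ≤ a) (hab : a ≤ b) :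
    ∑ q ∈ (Finset.Ioc a b).filter Nat.Prime, 1 / (q : ℝ) ≤
      Real.log 4 * (1 + Real.log (Real.log b / Real.log a)) := by
  have hlog : ∀ m : ℕ, a ≤ m → 0 < Real.log m := fun m hm =>
    Real.log_pos (by exact_mod_cast (by omega : 1 < m))
  have h1 := sum_primes_log_mul_le hab (w := fun m => 1 / ((m : ℝ) * Real.log m))
    (fun m hm => by
      have := hlog m hm.le
      have hm0 : (0 : ℝ) < m := by exact_mod_cast (by omega : 0 < m)
      push_cast
      gcongr <;> linarith)
    (fun m hm => by have := hlog m hm.le; positivity)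
  have h2 := sum_Ioc_le_sub hab (w := fun m => 1 / ((m : ℝ) * Real.log m))
    (F := fun m => Real.log (Real.log m))
    fun m hm => inv_mul_log_le_log_log_sub (by omega)
  have h3 : (a : ℝ) * (1 / (((a + 1 : ℕ) : ℝ) * Real.log (a + 1 : ℕ))) ≤ 1 := by
    have h4 : 1 ≤ Real.log (a + 1 : ℕ) := by
      rw [Real.le_log_iff_exp_le (by positivity)]
      have : (3 : ℝ) ≤ (a + 1 : ℕ) := by exact_mod_cast (by omega : 3 ≤ a + 1)
      linarith [Real.exp_one_lt_d9]
    rw [mul_one_div, div_le_one (by positivity)]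
    push_cast at h4 ⊢
    nlinarith [(Nat.cast_nonneg a : (0 : ℝ) ≤ a)]
  rw [Real.log_div (hlog b hab).ne' (hlog a le_rfl).ne']
  have h5 : ∑ q ∈ (Finset.Ioc a b).filter Nat.Prime, 1 / (q : ℝ) =
      ∑ q ∈ (Finset.Ioc a b).filter Nat.Prime, Real.log q * (1 / ((q : ℝ) * Real.log q)) := by
    refine Finset.sum_congr rfl fun q hq => ?_
    have hq' := (Finset.mem_Ioc.mp (Finset.mem_filter.mp hq).1).1
    have := (hlog q hq'.le).ne'
    field_simp
  rw [h5]
  refine h1.trans (mul_le_mul_of_nonneg_left ?_ (Real.log_nonneg (by norm_num)))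
  linarith

lemma mul_rpow_sub_one_mul_sub_le {u v β : ℝ} (hu : 0 ≤ u) (hv : 0 < v) (hβ : 0 ≤ β) (hβ1 : β ≤ 1) :
    β * v ^ (β - 1) * (v - u) ≤ v ^ β - u ^ β := by
  have h := rpow_one_add_le_one_add_mul_self (s := u / v - 1)
    (by have := div_nonneg hu hv.le; linarith) hβ hβ1
  rw [add_sub_cancel, Real.div_rpow hu hv.le, div_le_iff₀ (by positivity)] at h
  rw [Real.rpow_sub_one hv.ne']
  have : β * (v ^ β / v) * (v - u) = v ^ β - (1 + β * (u / v - 1)) * v ^ β := by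
    field_simp; ring
  linarith

lemma sum_primes_log_rpow_div_le {β : ℝ} (hβ : 0 < β) (hβ1 : β ≤ 1) {x : ℕ} (hx : 2 ≤ x) :
    ∑ p ∈ (Finset.Ioc 1 x).filter Nat.Prime, Real.log p ^ β / p ≤
      2 * Real.log 4 / β * Real.log x ^ β := by
  set w : ℕ → ℝ := fun m => Real.log m ^ (β - 1) / m with hw
  have hlog : ∀ m : ℕ, 1 < m → 0 < Real.log m := fun m hm =>
    Real.log_pos (by exact_mod_cast hm)
  have hw0 : ∀ m : ℕ, 1 < m → 0 ≤ w m := fun m hm => by have := hlog m hm; positivity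
  have h1 := sum_primes_log_mul_le (a := 1) (b := x) (by omega) (w := w)
    (fun m hm => by
      have h0 := hlog m hm
      have hm0 : (0 : ℝ) < m := by exact_mod_cast (by omega : 0 < m)
      have h2 : Real.log (m + 1 : ℕ) ^ (β - 1) ≤ Real.log m ^ (β - 1) :=
        Real.rpow_le_rpow_of_nonpos h0 (Real.log_le_log hm0 (by push_cast; linarith)) (by linarith)
      simp only [hw]
      gcongr
      omega) hw0
  have h2 : ∑ m ∈ Finset.Ioc 1 x, w m ≤ Real.log x ^ β / β - Real.log (1 : ℕ) ^ β / β := by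
    refine sum_Ioc_le_sub (by omega) (F := fun m => Real.log m ^ β / β) fun m hm => ?_
    have hm' : (1 : ℝ) < m := by exact_mod_cast hm
    have hv := hlog m hm
    have h3 := mul_rpow_sub_one_mul_sub_le (u := Real.log (m - 1 : ℕ)) (Real.log_natCast_nonneg _)
      hv hβ.le hβ1
    have h4 : 1 / (m : ℝ) ≤ Real.log m - Real.log (m - 1 : ℕ) := by
      rw [Nat.cast_sub hm.le, Nat.cast_one, ← Real.log_div (by linarith) (by linarith)]
      have := Real.one_sub_inv_le_log_of_pos (x := (m : ℝ) / (m - 1))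
        (div_pos (by linarith) (by linarith))
      rw [inv_div, one_sub_div (by linarith)] at this
      simpa using this
    rw [← sub_div, le_div_iff₀ hβ]
    refine le_trans ?_ h3
    have : w m * β = β * Real.log m ^ (β - 1) * (1 / m) := by simp only [hw]; ring
    rw [this]
    gcongr
  simp only [Nat.cast_one, Real.log_one, Real.zero_rpow hβ.ne', zero_div, sub_zero] at h2
  have h3 : w 2 ≤ ∑ m ∈ Finset.Ioc 1 x, w m :=
    Finset.single_le_sum (fun m hm => hw0 m (Finset.mem_Ioc.mp hm).1)
      (Finset.mem_Ioc.mpr ⟨one_lt_two, hx⟩)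
  have h4 : ∑ p ∈ (Finset.Ioc 1 x).filter Nat.Prime, Real.log p ^ β / p =
      ∑ p ∈ (Finset.Ioc 1 x).filter Nat.Prime, Real.log p * w p := by
    refine Finset.sum_congr rfl fun q hq => ?_
    have hq' := hlog q (Finset.mem_Ioc.mp (Finset.mem_filter.mp hq).1).1
    simp only [hw]
    rw [Real.rpow_sub_one hq'.ne']
    field_simp
  rw [h4]
  have h5 : 0 ≤ Real.log 4 := Real.log_nonneg (by norm_num)
  calc _ ≤ _ := h1
    _ ≤ Real.log 4 * (2 * (Real.log x ^ β / β)) := by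
      gcongr
      simp only [Nat.cast_one, one_mul, Nat.reduceAdd]
      linarith
    _ = _ := by ring

lemma sum_pow_card_filter_dvd_le {y : ℝ} (hy : 0 ≤ y) {Q : Finset ℕ} (hQ : ∀ q ∈ Q, q.Prime)
    (N : ℕ) :
    ∑ m ∈ Finset.Icc 1 N, (1 + y) ^ (Q.filter (· ∣ m)).card ≤
      N * Real.exp (y * ∑ q ∈ Q, 1 / (q : ℝ)) := by
  have h1 : ∀ m, (1 + y) ^ (Q.filter (· ∣ m)).card =
      ∑ R ∈ Q.powerset, if ∏ q ∈ R, q ∣ m then y ^ R.card else 0 := by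
    intro m
    rw [← Finset.prod_const, Finset.prod_one_add, ← Finset.sum_filter]
    refine Finset.sum_congr ?_ fun R _ => by simp
    ext R
    simp only [Finset.mem_powerset, Finset.mem_filter, Finset.subset_iff]
    constructor
    · intro h
      refine ⟨fun q hq => (h hq).1, Finset.prod_primes_dvd m (fun q hq => (hQ q (h hq).1).prime)
        fun q hq => (h hq).2⟩
    · exact fun h q hq => ⟨h.1 hq, (Finset.dvd_prod_of_mem _ hq).trans h.2⟩
  have h2 : ∀ d : ℕ, (((Finset.Icc 1 N).filter (d ∣ ·)).card : ℝ) ≤ N / d := by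
    intro d
    have : (Finset.Icc 1 N).filter (d ∣ ·) = (Finset.Ioc 0 N).filter (d ∣ ·) := rfl
    rw [this, Nat.Ioc_filter_dvd_card_eq_div]
    exact Nat.cast_div_le
  calc ∑ m ∈ Finset.Icc 1 N, (1 + y) ^ (Q.filter (· ∣ m)).card
      = ∑ R ∈ Q.powerset, ((Finset.Icc 1 N).filter (∏ q ∈ R, q ∣ ·)).card * y ^ R.card := by
        simp_rw [h1]
        rw [Finset.sum_comm]
        refine Finset.sum_congr rfl fun R _ => ?_
        rw [← Finset.sum_filter, Finset.sum_const, nsmul_eq_mul]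
    _ ≤ ∑ R ∈ Q.powerset, N / (∏ q ∈ R, q : ℕ) * y ^ R.card := by
        gcongr
        exact h2 _
    _ = N * ∏ q ∈ Q, (1 + y * (1 / q)) := by
        rw [Finset.prod_one_add, Finset.mul_sum]
        refine Finset.sum_congr rfl fun R _ => ?_
        rw [Finset.prod_mul_distrib, Finset.prod_const, Finset.prod_div_distrib, Nat.cast_prod]
        simp only [Finset.prod_const_one]
        ring
    _ ≤ _ := by
        rw [Finset.mul_sum]
        gcongr
        exact Real.prod_one_add_le_exp_sum _ fun q => by positivity

lemma sum_rpow_le_sum_rpow {ι : Type*} (P : Finset ι) {f : ι → ℝ} (hf : ∀ i ∈ P, 0 ≤ f i) {s : ℝ}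
    (hs : 0 < s) (hs1 : s ≤ 1) : (∑ i ∈ P, f i) ^ s ≤ ∑ i ∈ P, f i ^ s := by
  induction P using Finset.induction_on with
  | empty => simp [Real.zero_rpow hs.ne']
  | insert a P ha ih =>
    rw [Finset.sum_insert ha, Finset.sum_insert ha]
    have h0 : ∀ i ∈ P, 0 ≤ f i := fun i hi => hf i (Finset.mem_insert_of_mem hi)
    exact (Real.rpow_add_le_add_rpow (hf a (Finset.mem_insert_self a P)) (Finset.sum_nonneg h0)
      hs.le hs1).trans (by linarith [ih h0])

lemma sum_filter_dvd_pow_card_le {y : ℝ} (hy : 0 ≤ y) {p x : ℕ} (hp : p.Prime) (hpx : p ≤ x) :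
    ∑ n ∈ (Finset.Icc 1 x).filter (p ∣ ·), (1 + y) ^ (n.primeFactors.filter (p < ·)).card ≤
      x / p * (Real.exp (y * Real.log 4) *
        (Real.log x / Real.log p) ^ (y * Real.log 4)) := by
  set Q := (Finset.Ioc p x).filter Nat.Prime with hQ
  have hQp : ∀ q ∈ Q, q.Prime := fun q hq => (Finset.mem_filter.mp hq).2
  have h1 : ∑ n ∈ (Finset.Icc 1 x).filter (p ∣ ·), (1 + y) ^ (n.primeFactors.filter (p < ·)).card ≤
      ∑ m ∈ Finset.Icc 1 (x / p), (1 + y) ^ (Q.filter (· ∣ m)).card := by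
    refine le_of_eq (Finset.sum_bij' (fun n _ => n / p) (fun m _ => p * m) ?_ ?_ ?_ ?_ ?_)
    · intro n hn
      simp only [Finset.mem_filter, Finset.mem_Icc] at hn ⊢
      exact ⟨Nat.div_pos (Nat.le_of_dvd hn.1.1 hn.2) hp.pos, Nat.div_le_div_right hn.1.2⟩
    · intro m hm
      simp only [Finset.mem_filter, Finset.mem_Icc] at hm ⊢
      refine ⟨⟨Nat.mul_pos hp.pos hm.1, ?_⟩, dvd_mul_right p m⟩
      exact (Nat.mul_le_mul_left p hm.2).trans (Nat.mul_div_le x p)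
    · intro n hn
      exact Nat.mul_div_cancel' (Finset.mem_filter.mp hn).2
    · intro m hm
      exact Nat.mul_div_cancel_left m hp.pos
    · intro n hn
      simp only [Finset.mem_filter, Finset.mem_Icc] at hn
      obtain ⟨⟨hn1, hnx⟩, m, rfl⟩ := hn
      rw [Nat.mul_div_cancel_left m hp.pos]
      congr 2
      ext q
      simp only [hQ, Finset.mem_filter, Nat.mem_primeFactors, Finset.mem_Ioc]
      constructor
      · rintro ⟨⟨hq, hqd, -⟩, hpq⟩
        refine ⟨⟨⟨hpq, (Nat.le_of_dvd hn1 hqd).trans hnx⟩, hq⟩, ?_⟩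
        refine (hq.dvd_mul.mp hqd).resolve_left fun h => ?_
        exact hpq.ne' ((Nat.prime_dvd_prime_iff_eq hq hp).mp h)
      · rintro ⟨⟨⟨hpq, -⟩, hq⟩, hqm⟩
        exact ⟨⟨hq, hqm.mul_left p, by omega⟩, hpq⟩
  have hlp : 0 < Real.log p := Real.log_pos (by exact_mod_cast hp.one_lt)
  have hlx : 0 < Real.log x := Real.log_pos (by exact_mod_cast hp.one_lt.trans_le hpx)
  have h2 : Real.exp (y * ∑ q ∈ Q, 1 / (q : ℝ)) ≤ Real.exp (y * Real.log 4) *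
      (Real.log x / Real.log p) ^ (y * Real.log 4) := by
    rw [Real.rpow_def_of_pos (by positivity), ← Real.exp_add]
    refine Real.exp_le_exp.mpr ?_
    have := mul_le_mul_of_nonneg_left (sum_primes_inv_le hp.two_le hpx) hy
    refine this.trans (le_of_eq (by ring))
  refine h1.trans ((sum_pow_card_filter_dvd_le hy hQp _).trans ?_)
  exact mul_le_mul Nat.cast_div_le h2 (by positivity) (by positivity)

lemma two_rpow_le : (2 : ℝ) ^ (1 / 20 : ℝ) ≤ 1 + 353 / 10000 := by
  have h : (2 : ℝ) ≤ (1 + 353 / 10000) ^ (20 : ℝ) := by norm_num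
  calc (2 : ℝ) ^ (1 / 20 : ℝ) ≤ ((1 + 353 / 10000) ^ (20 : ℝ)) ^ (1 / 20 : ℝ) := by gcongr
    _ = 1 + 353 / 10000 := by
      rw [← Real.rpow_mul (by norm_num)]
      norm_num

lemma chainSum_nonneg (P : Finset ℕ) : 0 ≤ chainSum P :=
  Finset.sum_nonneg fun p _ => by have := Real.log_natCast_nonneg p; positivity

/-- The exponent `1 / 20` is small enough that `(2 ^ s - 1) * log 4 < s`, so that the constant in
Chebyshev's bound suffices. -/
lemma exists_sum_chainSum_rpow_le : ∃ C : ℝ, 0 < C ∧ ∀ x : ℕ, 2 ≤ x →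
    ∑ n ∈ Finset.Icc 1 x, chainSum n.primeFactors ^ (1 / 20 : ℝ) ≤
      C * (x * Real.log x ^ (1 / 20 : ℝ)) := by
  set y : ℝ := 353 / 10000 with hy
  have hy0 : 0 ≤ y := by norm_num
  set α := y * Real.log 4 with hα
  set β := 1 / 20 - α with hβ
  have hl4 : Real.log 4 = 2 * Real.log 2 := by
    rw [show (4 : ℝ) = 2 ^ 2 by norm_num, Real.log_pow]; norm_num
  have hl4' : 0 < Real.log 4 := Real.log_pos (by norm_num)
  have hβ0 : 0 < β := by
    rw [hβ, hα, hl4, hy]; linarith [Real.log_two_lt_d9]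
  have hα0 : 0 ≤ α := by positivity
  have hβ1 : β ≤ 1 := by linarith
  refine ⟨Real.exp α * (2 * Real.log 4 / β), by positivity, fun x hx => ?_⟩
  have hlx : 0 < Real.log x := Real.log_pos (by exact_mod_cast hx)
  have hterm : ∀ n : ℕ, chainSum n.primeFactors ^ (1 / 20 : ℝ) ≤
      ∑ p ∈ n.primeFactors, (1 + y) ^ (n.primeFactors.filter (p < ·)).card *
        Real.log p ^ (1 / 20 : ℝ) := by
    intro n
    refine (sum_rpow_le_sum_rpow _ (fun p _ => ?_) (by norm_num) (by norm_num)).trans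
      (Finset.sum_le_sum fun p _ => ?_)
    · have := Real.log_natCast_nonneg p
      positivity
    · have hlp := Real.log_natCast_nonneg p
      rw [Real.mul_rpow (by positivity) hlp, ← Real.rpow_natCast, ← Real.rpow_mul (by norm_num),
        mul_comm (_ : ℝ) (1 / 20 : ℝ), Real.rpow_mul (by norm_num), Real.rpow_natCast]
      gcongr
      exact two_rpow_le
  calc ∑ n ∈ Finset.Icc 1 x, chainSum n.primeFactors ^ (1 / 20 : ℝ)
      ≤ ∑ n ∈ Finset.Icc 1 x, ∑ p ∈ n.primeFactors,
          (1 + y) ^ (n.primeFactors.filter (p < ·)).card * Real.log p ^ (1 / 20 : ℝ) :=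
        Finset.sum_le_sum fun n _ => hterm n
    _ = ∑ p ∈ (Finset.Ioc 1 x).filter Nat.Prime, ∑ n ∈ (Finset.Icc 1 x).filter (p ∣ ·),
          (1 + y) ^ (n.primeFactors.filter (p < ·)).card * Real.log p ^ (1 / 20 : ℝ) := by
        refine Finset.sum_comm' fun n p => ?_
        simp only [Finset.mem_filter, Finset.mem_Icc, Finset.mem_Ioc, Nat.mem_primeFactors]
        constructor
        · rintro ⟨⟨h1, h2⟩, hp, hd, -⟩
          exact ⟨⟨⟨h1, h2⟩, hd⟩, ⟨hp.one_lt, (Nat.le_of_dvd h1 hd).trans h2⟩, hp⟩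
        · rintro ⟨⟨⟨h1, h2⟩, hd⟩, -, hp⟩
          exact ⟨⟨h1, h2⟩, hp, hd, by omega⟩
    _ ≤ ∑ p ∈ (Finset.Ioc 1 x).filter Nat.Prime,
          x * Real.exp α * Real.log x ^ α * (Real.log p ^ β / p) := by
        refine Finset.sum_le_sum fun p hp => ?_
        simp only [Finset.mem_filter, Finset.mem_Ioc] at hp
        have hlp : 0 < Real.log p := Real.log_pos (by exact_mod_cast hp.1.1)
        rw [← Finset.sum_mul]
        refine (mul_le_mul_of_nonneg_right (sum_filter_dvd_pow_card_le hy0 hp.2 hp.1.2)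
          (by positivity)).trans (le_of_eq ?_)
        rw [← hα, Real.div_rpow hlx.le hlp.le, hβ, Real.rpow_sub hlp]
        field_simp
    _ ≤ x * Real.exp α * Real.log x ^ α * (2 * Real.log 4 / β * Real.log x ^ β) := by
        rw [← Finset.mul_sum]
        gcongr
        exact sum_primes_log_rpow_div_le hβ0 hβ1 hx
    _ = Real.exp α * (2 * Real.log 4 / β) * (x * Real.log x ^ (1 / 20 : ℝ)) := by
        rw [show (1 / 20 : ℝ) = α + β by rw [hβ]; ring, Real.rpow_add hlx]
        ring

lemma card_filter_chainSum_gt_le {C K : ℝ} (hK : 0 < K) {x : ℕ} (hx : 2 ≤ x)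
    (h : ∑ n ∈ Finset.Icc 1 x, chainSum n.primeFactors ^ (1 / 20 : ℝ) ≤
      C * (x * Real.log x ^ (1 / 20 : ℝ))) :
    (((Finset.Icc 1 x).filter (fun n => K * Real.log x < chainSum n.primeFactors)).card : ℝ) ≤
      C / K ^ (1 / 20 : ℝ) * x := by
  have hlx : 0 < Real.log x := Real.log_pos (by exact_mod_cast hx)
  set T := (Finset.Icc 1 x).filter (fun n => K * Real.log x < chainSum n.primeFactors) with hT
  have h1 : (T.card : ℝ) * (K * Real.log x) ^ (1 / 20 : ℝ) ≤
      C * (x * Real.log x ^ (1 / 20 : ℝ)) := by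
    calc (T.card : ℝ) * (K * Real.log x) ^ (1 / 20 : ℝ)
        = ∑ n ∈ T, (K * Real.log x) ^ (1 / 20 : ℝ) := by rw [Finset.sum_const, nsmul_eq_mul]
      _ ≤ ∑ n ∈ T, chainSum n.primeFactors ^ (1 / 20 : ℝ) :=
          Finset.sum_le_sum fun n hn => Real.rpow_le_rpow (by positivity)
            (Finset.mem_filter.mp hn).2.le (by norm_num)
      _ ≤ ∑ n ∈ Finset.Icc 1 x, chainSum n.primeFactors ^ (1 / 20 : ℝ) :=
          Finset.sum_le_sum_of_subset_of_nonneg (Finset.filter_subset _ _)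
            fun n _ _ => Real.rpow_nonneg (chainSum_nonneg _) _
      _ ≤ _ := h
  rw [Real.mul_rpow hK.le hlx.le, ← mul_assoc, ← mul_assoc] at h1
  have h2 := le_of_mul_le_mul_right h1 (by positivity)
  rw [div_mul_eq_mul_div, le_div_iff₀ (by positivity)]
  exact h2

/-- If ψ(n) → ∞ then A₀(n) ≤ n^{ψ(n)} for almost all n. -/
theorem max_divisor_cyclotomic_height_bound (ψ : ℕ → ℝ)
    (hψ : Tendsto ψ atTop atTop) :
    Tendsto (fun x : ℕ =>
        (((Finset.Icc 1 x).filter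
          (fun n => (A0 n : ℝ) > (n : ℝ) ^ (ψ n))).card : ℝ) / (x : ℝ))
      atTop (nhds 0) := by
  obtain ⟨C, hC, hsum⟩ := exists_sum_chainSum_rpow_le
  rw [Metric.tendsto_atTop']
  intro ε hε
  obtain ⟨K, hKε, hK⟩ : ∃ K : ℝ, C / K ^ (1 / 20 : ℝ) < ε / 3 ∧ 0 < K := by
    have h1 : Tendsto (fun K : ℝ => C / K ^ (1 / 20 : ℝ)) atTop (nhds 0) :=
      (tendsto_rpow_atTop (by norm_num)).const_div_atTop C
    exact ((h1.eventually_lt_const (by positivity)).and (eventually_gt_atTop 0)).exists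
  obtain ⟨N, hN⟩ := eventually_atTop.mp (hψ.eventually_ge_atTop (8 * K))
  have hNx : ∀ᶠ x : ℕ in atTop, (N : ℝ) / x < ε / 3 :=
    (tendsto_natCast_atTop_atTop.const_div_atTop (N : ℝ)).eventually_lt_const (by positivity)
  have hsx : ∀ᶠ x : ℕ in atTop, 1 / √(x : ℝ) < ε / 3 :=
    ((Real.tendsto_sqrt_atTop.comp tendsto_natCast_atTop_atTop).const_div_atTop
      (1 : ℝ)).eventually_lt_const (by positivity)
  obtain ⟨M, hM⟩ := eventually_atTop.mp (hNx.and (hsx.and (eventually_ge_atTop 2)))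
  refine ⟨M, fun x hxM => ?_⟩
  obtain ⟨hNx, hsx, hx2⟩ := hM x hxM.le
  have hx0 : (0 : ℝ) < x := by exact_mod_cast (by omega : 0 < x)
  have hsub : (Finset.Icc 1 x).filter (fun n => (A0 n : ℝ) > (n : ℝ) ^ (ψ n)) ⊆
      Finset.Icc 1 N ∪ Finset.Icc 1 x.sqrt ∪
        (Finset.Icc 1 x).filter (fun n => K * Real.log x < chainSum n.primeFactors) := by
    intro n hn
    simp only [Finset.mem_filter, Finset.mem_Icc, Finset.mem_union] at hn ⊢
    obtain ⟨⟨hn1, hnx⟩, hA⟩ := hn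
    by_cases hnN : n ≤ N
    · exact Or.inl (Or.inl ⟨hn1, hnN⟩)
    by_cases hns : n ≤ x.sqrt
    · exact Or.inl (Or.inr ⟨hn1, hns⟩)
    refine Or.inr ⟨⟨hn1, hnx⟩, ?_⟩
    have hn0 : (0 : ℝ) < n := by exact_mod_cast hn1
    have h1 : ψ n * Real.log n < 4 * chainSum n.primeFactors := by
      have := lt_of_lt_of_le hA (A0_le_exp_chainSum (by omega))
      rwa [Real.rpow_def_of_pos hn0, Real.exp_lt_exp, mul_comm] at this
    have h2 : Real.log x ≤ 2 * Real.log n := by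
      have h3 : (x : ℝ) ≤ (n : ℝ) ^ 2 := by
        rw [not_le, Nat.sqrt_lt'] at hns
        exact_mod_cast hns.le
      simpa using Real.log_le_log hx0 h3
    have h3 := mul_le_mul_of_nonneg_right (hN n (by omega)) (Real.log_natCast_nonneg n)
    have h4 := mul_le_mul_of_nonneg_left h2 hK.le
    linarith
  have hcard : (((Finset.Icc 1 x).filter
      (fun n => (A0 n : ℝ) > (n : ℝ) ^ (ψ n))).card : ℝ) ≤
      N + √x + C / K ^ (1 / 20 : ℝ) * x := by
    have h1 := (Finset.card_le_card hsub).trans ((Finset.card_union_le _ _).trans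
      (Nat.add_le_add_right (Finset.card_union_le _ _) _))
    rw [Nat.card_Icc, Nat.card_Icc, Nat.add_sub_cancel, Nat.add_sub_cancel] at h1
    have h2 := card_filter_chainSum_gt_le hK hx2 (hsum x hx2)
    have h3 : (x.sqrt : ℝ) ≤ √x := Real.nat_sqrt_le_real_sqrt
    have h4 : (((Finset.Icc 1 x).filter
      (fun n => (A0 n : ℝ) > (n : ℝ) ^ (ψ n))).card : ℝ) ≤ N + x.sqrt +
        ((Finset.Icc 1 x).filter
          (fun n => K * Real.log x < chainSum n.primeFactors)).card := by exact_mod_cast h1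
    linarith
  rw [Real.dist_0_eq_abs, abs_of_nonneg (by positivity)]
  calc _ ≤ (N + √x + C / K ^ (1 / 20 : ℝ) * x) / x := by gcongr
    _ = N / x + 1 / √x + C / K ^ (1 / 20 : ℝ) := by
      rw [add_div, add_div, mul_div_cancel_right₀ _ hx0.ne', Real.sqrt_div_self']
    _ < ε := by linarith
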